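/- For real numbers 0 < a < b, the improper integral ∫₀^∞ e^{iat} J₀(bt) dt converges and equals 1/√(b² − a²). -/

import Mathlib

open Real MeasureTheory

/-- Bessel function of the first kind of integer order `n`. -/
noncomputable def besselJ (n : ℕ) (x : ℝ) : ℝ :=
  ∑' m : ℕ, (-1 : ℝ)^m / (m.factorial * (m+n).factorial) * (x/2)^(2*m+n)

open Filter Set

/-- The entire function `z ↦ ∑ (-z)^m / (m! (m+n)!)`, related to the Bessel function by
`besselJ n x = (x/2)^n * besselClifford n (x^2/4)`. -/
noncomputable def besselClifford (n : ℕ) (z : ℝ) : ℝ :=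
  ∑' m : ℕ, (-1 : ℝ) ^ m / (m.factorial * (m + n).factorial) * z ^ m

lemma summable_besselClifford (n : ℕ) (z : ℝ) :
    Summable fun m : ℕ => (-1 : ℝ) ^ m / (m.factorial * (m + n).factorial) * z ^ m := by
  refine Summable.of_norm_bounded (Real.summable_pow_div_factorial |z|) fun m => ?_
  have h₁ : (1 : ℝ) ≤ (m + n).factorial := by exact_mod_cast Nat.factorial_pos _
  have h₂ : (0 : ℝ) < m.factorial := by exact_mod_cast Nat.factorial_pos _
  rw [norm_mul, norm_div, norm_pow, norm_pow, norm_mul]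
  simp only [norm_neg, norm_one, one_pow, Real.norm_eq_abs, Nat.abs_cast]
  rw [div_mul_eq_mul_div, one_mul]
  gcongr
  nlinarith

lemma hasDerivAt_besselClifford (n : ℕ) (z : ℝ) :
    HasDerivAt (besselClifford n) (-besselClifford (n + 1) z) z := by
  set r : ℝ := |z| + 1
  have hr : 0 ≤ r := by positivity
  have hu : Summable fun m : ℕ => (m : ℝ) * r ^ (m - 1) / m.factorial := by
    rw [← summable_nat_add_iff 1]
    refine (Real.summable_pow_div_factorial r).congr fun m => ?_
    rw [Nat.factorial_succ]
    push_cast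
    rw [mul_div_mul_left _ _ (by positivity)]
  have key := hasDerivAt_tsum_of_isPreconnected (y := z) (y₀ := z)
    (g := fun (m : ℕ) (x : ℝ) => (-1 : ℝ) ^ m / (m.factorial * (m + n).factorial) * x ^ m)
    (g' := fun (m : ℕ) (x : ℝ) =>
      (-1 : ℝ) ^ m / (m.factorial * (m + n).factorial) * (m * x ^ (m - 1)))
    hu (Metric.isOpen_ball (x := (0 : ℝ)) (ε := r)) (convex_ball _ _).isPreconnected
    (fun m x _ => (hasDerivAt_pow m x).const_mul _) ?_ (by simp [r])
    (summable_besselClifford n z) (by simp [r])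
  · refine key.congr_deriv ?_
    have hs : Summable fun m : ℕ =>
        (-1 : ℝ) ^ m / (m.factorial * (m + n).factorial) * (m * z ^ (m - 1)) := by
      rw [← summable_nat_add_iff 1]
      refine (summable_besselClifford (n + 1) z).neg.congr fun m => ?_
      rw [Nat.factorial_succ, show m + 1 + n = m + (n + 1) by ring]
      have := Nat.factorial_ne_zero m
      have := Nat.factorial_ne_zero (m + (n + 1))
      push_cast
      field_simp
      simp [pow_succ, mul_comm]
    rw [hs.tsum_eq_zero_add, besselClifford, ← tsum_neg]
    simp only [CharP.cast_eq_zero, zero_mul, mul_zero, zero_add]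
    refine tsum_congr fun m => ?_
    rw [Nat.factorial_succ, show m + 1 + n = m + (n + 1) by ring]
    have := Nat.factorial_ne_zero m
    have := Nat.factorial_ne_zero (m + (n + 1))
    push_cast
    field_simp
    simp [pow_succ, mul_comm]
  · intro m x hx
    have hx' : |x| ≤ r := by simpa using (mem_ball_zero_iff.mp hx).le
    have h₁ : (1 : ℝ) ≤ (m + n).factorial := by exact_mod_cast Nat.factorial_pos _
    have h₂ : (0 : ℝ) < m.factorial := by exact_mod_cast Nat.factorial_pos _
    rw [norm_mul, norm_div, norm_pow, norm_mul, norm_mul, norm_pow]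
    simp only [norm_neg, norm_one, one_pow, Real.norm_eq_abs, Nat.abs_cast]
    rw [div_mul_eq_mul_div, one_mul]
    gcongr
    nlinarith

lemma besselClifford_recurrence (n : ℕ) (z : ℝ) :
    besselClifford n z = (n + 1) * besselClifford (n + 1) z - z * besselClifford (n + 2) z := by
  have h := (summable_besselClifford (n + 1) z).mul_left ((n : ℝ) + 1)
  have hn := summable_besselClifford n z
  rw [besselClifford, besselClifford, besselClifford, ← tsum_mul_left, ← tsum_mul_left,
    h.tsum_eq_zero_add, hn.tsum_eq_zero_add, add_sub_assoc,
    ← Summable.tsum_sub ((summable_nat_add_iff 1).mpr h)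
      ((summable_besselClifford (n + 2) z).mul_left z)]
  congr 1
  · simp only [Nat.factorial_zero, zero_add, Nat.factorial_succ]
    have := Nat.factorial_ne_zero n
    push_cast
    field_simp
  · refine tsum_congr fun m => ?_
    rw [show m + 1 + (n + 1) = m + n + 1 + 1 by ring, show m + (n + 2) = m + n + 1 + 1 by ring,
      show m + 1 + n = m + n + 1 by ring, Nat.factorial_succ (m + n + 1), Nat.factorial_succ m]
    have := Nat.factorial_ne_zero m
    have := Nat.factorial_ne_zero (m + n + 1)
    push_cast
    field_simp
    ring

lemma besselJ_zero_eq (t : ℝ) : besselJ 0 t = besselClifford 0 (t ^ 2 / 4) := by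
  refine tsum_congr fun m => ?_
  rw [add_zero, add_zero, pow_mul]
  ring_nf

lemma besselJ_zero_at_zero : besselJ 0 0 = 1 := by
  rw [besselJ_zero_eq, besselClifford, tsum_eq_single 0]
  · simp
  · intro m hm
    simp [hm]

/-- The entire extension of `J₀'(t) / t`. -/
noncomputable def besselQ (t : ℝ) : ℝ := -besselClifford 1 (t ^ 2 / 4) / 2

lemma hasDerivAt_sq_div_four (t : ℝ) : HasDerivAt (fun x : ℝ => x ^ 2 / 4) (t / 2) t := by
  refine ((hasDerivAt_pow 2 t).div_const 4).congr_deriv ?_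
  norm_num
  ring

lemma hasDerivAt_besselJ_zero (t : ℝ) : HasDerivAt (besselJ 0) (t * besselQ t) t := by
  rw [funext besselJ_zero_eq]
  refine ((hasDerivAt_besselClifford 0 (t ^ 2 / 4)).comp t
    (hasDerivAt_sq_div_four t)).congr_deriv ?_
  rw [besselQ]
  ring

/-- Bessel's equation of order `0`. -/
lemma hasDerivAt_mul_besselQ (t : ℝ) :
    HasDerivAt (fun x => x * besselQ x) (-besselJ 0 t - besselQ t) t := by
  have h : HasDerivAt besselQ (-(-besselClifford 2 (t ^ 2 / 4) * (t / 2)) / 2) t := by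
    have h' := (hasDerivAt_besselClifford 1 (t ^ 2 / 4)).comp t (hasDerivAt_sq_div_four t)
    exact h'.fun_neg.div_const 2
  refine ((hasDerivAt_id t).fun_mul h).congr_deriv ?_
  have := besselClifford_recurrence 0 (t ^ 2 / 4)
  rw [besselJ_zero_eq, this]
  simp only [besselQ, id]
  push_cast
  ring

lemma continuous_besselJ_zero : Continuous (besselJ 0) :=
  continuous_iff_continuousAt.mpr fun t => (hasDerivAt_besselJ_zero t).continuousAt

lemma continuous_besselQ : Continuous besselQ := by
  have h : Continuous (besselClifford 1) :=
    continuous_iff_continuousAt.mpr fun z => (hasDerivAt_besselClifford 1 z).continuousAt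
  unfold besselQ
  fun_prop

lemma besselJ_sq_add_sq_le_one {t : ℝ} (ht : 0 ≤ t) :
    besselJ 0 t ^ 2 + (t * besselQ t) ^ 2 ≤ 1 := by
  have hd : ∀ x : ℝ, HasDerivAt (fun x => besselJ 0 x ^ 2 + (x * besselQ x) ^ 2)
      (-2 * x * besselQ x ^ 2) x := fun x => by
    refine (((hasDerivAt_besselJ_zero x).fun_pow 2).fun_add
      ((hasDerivAt_mul_besselQ x).fun_pow 2)).congr_deriv ?_
    push_cast
    ring
  have hanti : AntitoneOn (fun x => besselJ 0 x ^ 2 + (x * besselQ x) ^ 2) (Ici 0) := by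
    refine antitoneOn_of_deriv_nonpos (convex_Ici 0)
      (fun x _ => (hd x).continuousAt.continuousWithinAt)
      (fun x _ => (hd x).differentiableAt.differentiableWithinAt) fun x hx => ?_
    rw [interior_Ici, mem_Ioi] at hx
    rw [(hd x).deriv]
    nlinarith [mul_nonneg hx.le (sq_nonneg (besselQ x))]
  simpa [besselJ_zero_at_zero] using hanti self_mem_Ici ht ht

/-- The energy of `√t J₀(t)` is nonincreasing, so `J₀² + J₀'²` is `O(1/t)`. -/
lemma exists_besselJ_sq_add_sq_le_div :
    ∃ C : ℝ, 0 ≤ C ∧ ∀ t : ℝ, 1 ≤ t → besselJ 0 t ^ 2 + (t * besselQ t) ^ 2 ≤ C / t := by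
  set E : ℝ → ℝ := fun t => t * (besselJ 0 t ^ 2 + (t * besselQ t) ^ 2) +
    besselJ 0 t * (t * besselQ t) + besselJ 0 t ^ 2 / (2 * t) with hE
  have hd : ∀ x : ℝ, 0 < x → HasDerivAt E (-besselJ 0 x ^ 2 / (2 * x ^ 2)) x := fun x hx => by
    have hy := hasDerivAt_besselJ_zero x
    have hp := hasDerivAt_mul_besselQ x
    refine ((((hasDerivAt_id x).fun_mul ((hy.fun_pow 2).fun_add (hp.fun_pow 2))).fun_add
      (hy.fun_mul hp)).fun_add
      ((hy.fun_pow 2).fun_div ((hasDerivAt_id x).const_mul 2) (by simpa using hx.ne'))).congr_deriv ?_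
    simp only [id]
    field_simp
    push_cast
    ring
  have hanti : AntitoneOn E (Ici 1) := by
    refine antitoneOn_of_deriv_nonpos (convex_Ici 1)
      (fun x hx => (hd x (zero_lt_one.trans_le hx)).continuousAt.continuousWithinAt)
      (fun x hx => ?_) fun x hx => ?_ <;>
      rw [interior_Ici, mem_Ioi] at hx
    · exact (hd x (by linarith)).differentiableAt.differentiableWithinAt
    · rw [(hd x (by linarith)).deriv, neg_div]
      have : 0 ≤ besselJ 0 x ^ 2 / (2 * x ^ 2) := by positivity
      linarith
  have hlow : ∀ t : ℝ, 1 ≤ t →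
      t * (besselJ 0 t ^ 2 + (t * besselQ t) ^ 2) ≤ 2 * E t := fun t ht => by
    have h₁ : 0 ≤ besselJ 0 t ^ 2 / (2 * t) := by positivity
    have h₂ := sq_nonneg (besselJ 0 t + t * besselQ t)
    have h₃ : 0 ≤ (t - 1) * (besselJ 0 t ^ 2 + (t * besselQ t) ^ 2) :=
      mul_nonneg (by linarith) (by positivity)
    simp only [hE]
    nlinarith
  refine ⟨2 * E 1, le_trans (by positivity) (hlow 1 le_rfl), fun t ht => ?_⟩
  rw [le_div_iff₀ (by linarith), mul_comm]
  exact (hlow t ht).trans (by linarith [hanti self_mem_Ici ht ht])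

lemma abs_besselJ_zero_le_one {t : ℝ} (ht : 0 ≤ t) : |besselJ 0 t| ≤ 1 := by
  rw [← sq_le_one_iff_abs_le_one]
  nlinarith [besselJ_sq_add_sq_le_one ht, sq_nonneg (t * besselQ t)]

lemma abs_mul_besselQ_le_one {t : ℝ} (ht : 0 ≤ t) : |t * besselQ t| ≤ 1 := by
  rw [← sq_le_one_iff_abs_le_one]
  nlinarith [besselJ_sq_add_sq_le_one ht, sq_nonneg (besselJ 0 t)]

lemma tendsto_besselJ_sq_add_sq :
    Tendsto (fun t => besselJ 0 t ^ 2 + (t * besselQ t) ^ 2) atTop (nhds 0) := by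
  obtain ⟨C, -, hC⟩ := exists_besselJ_sq_add_sq_le_div
  refine squeeze_zero' (.of_forall fun t => by positivity) ?_ (tendsto_id.const_div_atTop C)
  filter_upwards [eventually_ge_atTop 1] with t ht using hC t ht

lemma tendsto_zero_of_tendsto_sq {f : ℝ → ℝ} {l : Filter ℝ}
    (h : Tendsto (fun t => f t ^ 2) l (nhds 0)) : Tendsto f l (nhds 0) := by
  refine (tendsto_zero_iff_abs_tendsto_zero f).mpr ?_
  simpa [Function.comp_def, Real.sqrt_sq_eq_abs] using h.sqrt

lemma tendsto_besselJ_zero : Tendsto (besselJ 0) atTop (nhds 0) :=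
  tendsto_zero_of_tendsto_sq <| squeeze_zero (fun _ => sq_nonneg _)
    (fun t => le_add_of_nonneg_right (sq_nonneg (t * besselQ t))) tendsto_besselJ_sq_add_sq

lemma tendsto_mul_besselQ : Tendsto (fun t => t * besselQ t) atTop (nhds 0) :=
  tendsto_zero_of_tendsto_sq <| squeeze_zero (fun _ => sq_nonneg _)
    (fun t => le_add_of_nonneg_left (sq_nonneg (besselJ 0 t))) tendsto_besselJ_sq_add_sq

lemma integrableOn_besselQ : IntegrableOn besselQ (Ioi 0) := by
  obtain ⟨C, hC0, hC⟩ := exists_besselJ_sq_add_sq_le_div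
  rw [← Ioc_union_Ioi_eq_Ioi zero_le_one]
  refine IntegrableOn.union
    ((continuous_besselQ.integrableOn_Icc (a := 0) (b := 1)).mono_set Ioc_subset_Icc_self) ?_
  refine Integrable.mono'
    ((integrableOn_Ioi_rpow_of_lt (a := -(3 / 2)) (by norm_num) zero_lt_one).const_mul (√C))
    continuous_besselQ.aestronglyMeasurable ?_
  refine (ae_restrict_iff' measurableSet_Ioi).mpr (.of_forall fun t (ht : 1 < t) => ?_)
  have ht0 : 0 < t := by linarith
  have h₁ : (t * besselQ t) ^ 2 ≤ C / t := by
    nlinarith [hC t ht.le, sq_nonneg (besselJ 0 t)]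
  rw [Real.norm_eq_abs]
  refine abs_le_of_sq_le_sq ?_ (by positivity)
  rw [mul_pow, Real.sq_sqrt hC0, ← Real.rpow_mul_natCast ht0.le,
    show -(3 / 2 : ℝ) * (2 : ℕ) = -(3 : ℕ) by norm_num, Real.rpow_neg ht0.le, Real.rpow_natCast,
    ← div_eq_mul_inv, le_div_iff₀ (by positivity)]
  rw [le_div_iff₀ ht0] at h₁
  linarith

/-- The Laplace transform of `J₀'(t) / t`. -/
noncomputable def laplaceBesselQ (s : ℂ) : ℂ :=
  ∫ t in Ioi (0 : ℝ), Complex.exp (-s * t) * (besselQ t : ℂ)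

lemma norm_exp_neg_mul (s : ℂ) (t : ℝ) : ‖Complex.exp (-s * t)‖ = Real.exp (-s.re * t) := by
  simp [Complex.norm_exp]

lemma continuous_exp_mul_besselQ (s : ℂ) :
    Continuous fun t : ℝ => Complex.exp (-s * t) * (besselQ t : ℂ) := by
  have := continuous_besselQ
  fun_prop

lemma norm_exp_mul_besselQ_le {s : ℂ} (hs : 0 ≤ s.re) {t : ℝ} (ht : 0 ≤ t) :
    ‖Complex.exp (-s * t) * (besselQ t : ℂ)‖ ≤ |besselQ t| := by
  rw [norm_mul, norm_exp_neg_mul, Complex.norm_real, Real.norm_eq_abs]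
  refine mul_le_of_le_one_left (abs_nonneg _) (Real.exp_le_one_iff.mpr ?_)
  nlinarith [mul_nonneg hs ht]

lemma integrableOn_exp_mul_besselQ {s : ℂ} (hs : 0 ≤ s.re) :
    IntegrableOn (fun t : ℝ => Complex.exp (-s * t) * (besselQ t : ℂ)) (Ioi 0) :=
  Integrable.mono' integrableOn_besselQ.abs (continuous_exp_mul_besselQ s).aestronglyMeasurable <|
    (ae_restrict_iff' measurableSet_Ioi).mpr <|
      .of_forall fun _ ht => norm_exp_mul_besselQ_le hs (le_of_lt ht)

lemma continuousOn_laplaceBesselQ : ContinuousOn laplaceBesselQ {s | 0 ≤ s.re} := fun s _ => by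
  refine continuousWithinAt_of_dominated
    (.of_forall fun z => (continuous_exp_mul_besselQ z).aestronglyMeasurable) ?_
    integrableOn_besselQ.abs (.of_forall fun t => Continuous.continuousWithinAt (by fun_prop))
  filter_upwards [self_mem_nhdsWithin] with z hz
  exact (ae_restrict_iff' measurableSet_Ioi).mpr <|
      .of_forall fun _ ht => norm_exp_mul_besselQ_le hz (le_of_lt ht)

lemma tendsto_laplaceBesselQ_atTop :
    Tendsto (fun x : ℝ => laplaceBesselQ x) atTop (nhds 0) := by
  have h := tendsto_integral_filter_of_dominated_convergence (l := atTop)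
    (μ := volume.restrict (Ioi (0 : ℝ)))
    (F := fun (x : ℝ) (t : ℝ) => Complex.exp (-(x : ℂ) * t) * (besselQ t : ℂ)) (f := fun _ => 0)
    _ (.of_forall fun x => (continuous_exp_mul_besselQ x).aestronglyMeasurable) ?_
    integrableOn_besselQ.abs ?_
  · simpa only [integral_zero, laplaceBesselQ] using h
  · filter_upwards [eventually_ge_atTop 0] with x hx
    exact (ae_restrict_iff' measurableSet_Ioi).mpr <|
      .of_forall fun _ ht => norm_exp_mul_besselQ_le (by simpa using hx) (le_of_lt ht)
  · refine (ae_restrict_iff' measurableSet_Ioi).mpr (.of_forall fun t (ht : 0 < t) => ?_)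
    rw [← zero_mul (besselQ t : ℂ)]
    refine Tendsto.mul_const _ (tendsto_zero_iff_norm_tendsto_zero.mpr ?_)
    simp only [norm_exp_neg_mul]
    simp only [Complex.ofReal_re, neg_mul]
    exact Real.tendsto_exp_neg_atTop_nhds_zero.comp (tendsto_id.atTop_mul_const ht)

lemma hasDerivAt_exp_neg_mul (s : ℂ) (t : ℝ) :
    HasDerivAt (fun x : ℝ => Complex.exp (-s * x)) (-s * Complex.exp (-s * t)) t := by
  refine ((Complex.ofRealCLM.hasDerivAt (x := t)).const_mul (-s)).cexp.congr_deriv ?_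
  simp
  ring

lemma hasDerivAt_laplaceBesselQ_aux {s : ℂ} (hs : 0 < s.re) :
    IntegrableOn (fun t : ℝ => -t * Complex.exp (-s * t) * (besselQ t : ℂ)) (Ioi 0) ∧
    HasDerivAt laplaceBesselQ
      (∫ t in Ioi (0 : ℝ), -t * Complex.exp (-s * t) * (besselQ t : ℂ)) s := by
  have hc := continuous_besselQ
  refine hasDerivAt_integral_of_dominated_loc_of_deriv_le (s := {z : ℂ | s.re / 2 < z.re})
    (bound := fun t => Real.exp (-(s.re / 2) * t))
    (F' := fun (z : ℂ) (t : ℝ) => -t * Complex.exp (-z * t) * (besselQ t : ℂ))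
    ((isOpen_lt continuous_const Complex.continuous_re).mem_nhds (by simpa using by linarith))
    (.of_forall fun z => (continuous_exp_mul_besselQ z).aestronglyMeasurable)
    (integrableOn_exp_mul_besselQ hs.le) (Continuous.aestronglyMeasurable (by fun_prop))
    ?_ (exp_neg_integrableOn_Ioi 0 (by linarith)) (.of_forall fun t z _ => ?_)
  · refine (ae_restrict_iff' measurableSet_Ioi).mpr (.of_forall fun t (ht : 0 < t) z hz => ?_)
    have h := abs_mul_besselQ_le_one ht.le
    rw [abs_mul, abs_of_pos ht] at h
    rw [norm_mul, norm_mul, norm_exp_neg_mul, norm_neg, Complex.norm_real, Complex.norm_real,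
      Real.norm_eq_abs, Real.norm_eq_abs, abs_of_pos ht, mul_right_comm]
    refine (mul_le_of_le_one_left (Real.exp_pos _).le h).trans (Real.exp_le_exp.mpr ?_)
    have hz' : s.re / 2 < z.re := hz
    nlinarith
  · refine (((hasDerivAt_id z).neg.mul_const (t : ℂ)).cexp.mul_const _).congr_deriv ?_
    simp [mul_comm]

lemma hasDerivAt_laplaceBesselQ {s : ℂ} (hs : 0 < s.re) (hs' : 1 + s ^ 2 ≠ 0) :
    HasDerivAt laplaceBesselQ ((1 + s * laplaceBesselQ s) / (1 + s ^ 2)) s := by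
  obtain ⟨hint, hderiv⟩ := hasDerivAt_laplaceBesselQ_aux hs
  refine hderiv.congr_deriv ?_
  rw [eq_div_iff hs']
  set f : ℝ → ℂ := fun t =>
    Complex.exp (-s * t) * (s * ((t * besselQ t : ℝ) : ℂ) - (besselJ 0 t : ℂ)) with hf
  have hfd : ∀ t : ℝ, HasDerivAt f ((-t * Complex.exp (-s * t) * (besselQ t : ℂ)) * (1 + s ^ 2) -
      s * (Complex.exp (-s * t) * (besselQ t : ℂ))) t := fun t => by
    refine ((hasDerivAt_exp_neg_mul s t).fun_mul
      (((hasDerivAt_mul_besselQ t).ofReal_comp.const_mul s).fun_sub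
        (hasDerivAt_besselJ_zero t).ofReal_comp)).congr_deriv ?_
    push_cast
    ring
  have hlim : Tendsto f atTop (nhds 0) := by
    rw [tendsto_zero_iff_norm_tendsto_zero]
    have hdec : Tendsto (fun t : ℝ => Real.exp (-s.re * t) * (‖s‖ + 1)) atTop (nhds 0) := by
      rw [← zero_mul (‖s‖ + 1)]
      refine Tendsto.mul_const _ ?_
      simp only [neg_mul]
      exact Real.tendsto_exp_neg_atTop_nhds_zero.comp (tendsto_id.const_mul_atTop hs)
    refine squeeze_zero' (.of_forall fun t => norm_nonneg _) ?_ hdec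
    filter_upwards [eventually_ge_atTop 0] with t ht
    rw [hf, norm_mul, norm_exp_neg_mul]
    gcongr
    refine (norm_sub_le _ _).trans ?_
    rw [norm_mul, Complex.norm_real, Complex.norm_real]
    exact add_le_add (mul_le_of_le_one_right (norm_nonneg _) (abs_mul_besselQ_le_one ht))
      (abs_besselJ_zero_le_one ht)
  have hint' := (integrableOn_exp_mul_besselQ hs.le).const_mul s
  have key := integral_Ioi_of_hasDerivAt_of_tendsto (a := 0)
    (hfd 0).continuousAt.continuousWithinAt (fun t _ => hfd t)
    ((hint.mul_const _).sub hint') hlim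
  rw [integral_sub (hint.mul_const _) hint', integral_mul_const, integral_const_mul] at key
  rw [sub_eq_iff_eq_add] at key
  rw [key, laplaceBesselQ]
  simp [hf, besselJ_zero_at_zero]

lemma one_add_sq_mem_slitPlane {s : ℂ} (hs : 0 < s.re) : 1 + s ^ 2 ∈ Complex.slitPlane := by
  rw [Complex.mem_slitPlane_iff]
  by_cases him : s.im = 0
  · left
    simp [pow_two, him]
    positivity
  · right
    have := mul_ne_zero hs.ne' him
    simp [pow_two]
    grind

lemma sub_laplaceBesselQ_eq {s : ℂ} (hs : 0 < s.re) :
    s - laplaceBesselQ s = (1 + s ^ 2) ^ (1 / 2 : ℂ) := by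
  set h : ℂ → ℂ := fun z => (z - laplaceBesselQ z) * (1 + z ^ 2) ^ (-1 / 2 : ℂ) with hh
  have hd : ∀ z : ℂ, 0 < z.re → HasDerivAt h 0 z := fun z hz => by
    have hm := one_add_sq_mem_slitPlane hz
    have hne := Complex.slitPlane_ne_zero hm
    refine (((hasDerivAt_id z).fun_sub (hasDerivAt_laplaceBesselQ hz hne)).fun_mul
      (((hasDerivAt_pow 2 z).const_add 1).cpow_const (c := -1 / 2) hm)).congr_deriv ?_
    rw [Complex.cpow_sub _ _ hne, Complex.cpow_one]
    simp only [id]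
    field_simp
    push_cast
    ring
  have hopen : IsOpen {z : ℂ | 0 < z.re} := isOpen_lt continuous_const Complex.continuous_re
  have hconst : ∀ x : ℝ, 0 < x → h x = h s := fun x hx =>
    hopen.is_const_of_deriv_eq_zero (convex_halfSpace_re_gt 0).isPreconnected
      (fun z hz => (hd z hz).differentiableAt.differentiableWithinAt)
      (fun z hz => (hd z hz).deriv) (by simpa using hx) hs
  have hlim : Tendsto (fun x : ℝ => h x) atTop (nhds 1) := by
    rw [tendsto_iff_norm_sub_tendsto_zero]
    have hb : Tendsto (fun x : ℝ => (1 + ‖laplaceBesselQ x‖) * x⁻¹) atTop (nhds 0) := by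
      simpa using (tendsto_laplaceBesselQ_atTop.norm.const_add 1).mul tendsto_inv_atTop_zero
    refine squeeze_zero' (.of_forall fun _ => norm_nonneg _) ?_ hb
    filter_upwards [eventually_gt_atTop 0] with x hx
    have hr : x ≤ √(1 + x ^ 2) := Real.le_sqrt_of_sq_le (by linarith)
    have hr' : √(1 + x ^ 2) ≤ x + 1 := Real.sqrt_le_iff.mpr ⟨by linarith, by nlinarith⟩
    have hpos : 0 < √(1 + x ^ 2) := by positivity
    have hpow : (1 + (x : ℂ) ^ 2) ^ (-1 / 2 : ℂ) = ((√(1 + x ^ 2))⁻¹ : ℝ) := by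
      rw [Real.sqrt_eq_rpow, ← Real.rpow_neg (by positivity), Complex.ofReal_cpow (by positivity)]
      push_cast
      norm_num
    have heq : h x - 1 = (((x - √(1 + x ^ 2) : ℝ) : ℂ) - laplaceBesselQ x) *
        ((√(1 + x ^ 2))⁻¹ : ℝ) := by
      have : ((√(1 + x ^ 2) : ℝ) : ℂ) ≠ 0 := by exact_mod_cast hpos.ne'
      simp only [hh]
      rw [hpow]
      push_cast
      field_simp
      ring
    rw [heq, norm_mul, Complex.norm_real, Real.norm_of_nonneg (by positivity)]
    gcongr
    refine (norm_sub_le _ _).trans (add_le_add_left ?_ _)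
    rw [Complex.norm_real, Real.norm_eq_abs, abs_le]
    constructor <;> linarith
  have hs1 : h s = 1 := by
    refine tendsto_nhds_unique (tendsto_const_nhds.congr' ?_) hlim
    filter_upwards [eventually_gt_atTop 0] with x hx using (hconst x hx).symm
  have hne := Complex.slitPlane_ne_zero (one_add_sq_mem_slitPlane hs)
  simp only [hh, neg_div, Complex.cpow_neg] at hs1
  exact (mul_inv_eq_one₀ (by simp [Complex.cpow_eq_zero_iff, hne])).mp hs1

lemma sub_laplaceBesselQ_neg_I_mul {c : ℝ} (hc : c ^ 2 < 1) :
    -(Complex.I * c) - laplaceBesselQ (-(Complex.I * c)) = (√(1 - c ^ 2) : ℝ) := by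
  have hp : Tendsto (fun x : ℝ => (x : ℂ) + -(Complex.I * c)) (nhdsWithin 0 (Ioi 0))
      (nhdsWithin (-(Complex.I * c)) {s | 0 ≤ s.re}) := by
    refine tendsto_nhdsWithin_iff.mpr ⟨?_, ?_⟩
    · refine Tendsto.mono_left ?_ nhdsWithin_le_nhds
      exact (Continuous.tendsto' (by fun_prop) _ _ (by simp))
    · filter_upwards [self_mem_nhdsWithin] with x hx
      simpa using le_of_lt hx
  have hcont := (continuousOn_laplaceBesselQ (-(Complex.I * c)) (by simp)).tendsto.comp hp
  have hp' := hp.mono_right nhdsWithin_le_nhds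
  have heq : 1 + (-(Complex.I * c)) ^ 2 = ((1 - c ^ 2 : ℝ) : ℂ) := by
    rw [neg_sq, mul_pow, Complex.I_sq]
    push_cast
    ring
  have hval : (1 + (-(Complex.I * c)) ^ 2) ^ (1 / 2 : ℂ) = ((√(1 - c ^ 2) : ℝ) : ℂ) := by
    rw [heq, Real.sqrt_eq_rpow, Complex.ofReal_cpow (by linarith)]
    norm_num
  rw [← hval]
  refine tendsto_nhds_unique (hp'.sub hcont) ?_
  have hright : Tendsto (fun x : ℝ => (1 + ((x : ℂ) + -(Complex.I * c)) ^ 2) ^ (1 / 2 : ℂ))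
      (nhdsWithin 0 (Ioi 0)) (nhds ((1 + (-(Complex.I * c)) ^ 2) ^ (1 / 2 : ℂ))) := by
    refine ((hp'.pow 2).const_add 1).cpow tendsto_const_nhds ?_
    rw [heq, Complex.ofReal_mem_slitPlane]
    linarith
  refine hright.congr' ?_
  filter_upwards [self_mem_nhdsWithin] with x hx
  exact (sub_laplaceBesselQ_eq (by simpa using hx)).symm

lemma one_add_sq_mul_integral_exp_mul_besselJ_zero (s : ℂ) (R : ℝ) :
    (1 + s ^ 2) * ∫ t in (0 : ℝ)..R, Complex.exp (-s * t) * (besselJ 0 t : ℂ) =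
      s - Complex.exp (-s * R) * (((R * besselQ R : ℝ) : ℂ) + s * (besselJ 0 R : ℂ)) -
        ∫ t in (0 : ℝ)..R, Complex.exp (-s * t) * (besselQ t : ℂ) := by
  have hcJ := continuous_besselJ_zero
  have hcQ := continuous_besselQ
  have hi₁ : IntervalIntegrable (fun t : ℝ => Complex.exp (-s * t) * (besselJ 0 t : ℂ))
      volume 0 R := Continuous.intervalIntegrable (by fun_prop) _ _
  have hi₂ : IntervalIntegrable (fun t : ℝ => Complex.exp (-s * t) * (besselQ t : ℂ))
      volume 0 R := Continuous.intervalIntegrable (by fun_prop) _ _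
  have hfd : ∀ t : ℝ, HasDerivAt (fun t : ℝ => Complex.exp (-s * t) *
      (((t * besselQ t : ℝ) : ℂ) + s * (besselJ 0 t : ℂ)))
      (-(1 + s ^ 2) * (Complex.exp (-s * t) * (besselJ 0 t : ℂ)) -
        Complex.exp (-s * t) * (besselQ t : ℂ)) t := fun t => by
    refine ((hasDerivAt_exp_neg_mul s t).fun_mul
      ((hasDerivAt_mul_besselQ t).ofReal_comp.fun_add
        ((hasDerivAt_besselJ_zero t).ofReal_comp.const_mul s))).congr_deriv ?_
    push_cast
    ring
  have key := intervalIntegral.integral_eq_sub_of_hasDerivAt (a := 0) (b := R)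
    (fun t _ => hfd t) ((hi₁.const_mul _).sub hi₂)
  rw [intervalIntegral.integral_sub (hi₁.const_mul _) hi₂,
    intervalIntegral.integral_const_mul] at key
  simp only [besselJ_zero_at_zero, Complex.ofReal_zero, mul_zero, Complex.exp_zero, zero_mul,
    Complex.ofReal_one, mul_one, one_mul, zero_add] at key
  linear_combination -key

lemma tendsto_integral_exp_mul_besselJ_zero {c : ℝ} (hc : c ^ 2 < 1) :
    Tendsto (fun R : ℝ => ∫ t in (0 : ℝ)..R, Complex.exp (Complex.I * c * t) * (besselJ 0 t : ℂ))
      atTop (nhds ((1 / √(1 - c ^ 2) : ℝ) : ℂ)) := by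
  set s : ℂ := -(Complex.I * c) with hs
  have hre : s.re = 0 := by simp [hs]
  have heq : 1 + s ^ 2 = ((1 - c ^ 2 : ℝ) : ℂ) := by
    rw [hs, neg_sq, mul_pow, Complex.I_sq]
    push_cast
    ring
  have hpos : 0 < 1 - c ^ 2 := by linarith
  have hne : 1 + s ^ 2 ≠ 0 := by
    rw [heq]
    exact_mod_cast hpos.ne'
  have hbdry : Tendsto (fun R : ℝ => Complex.exp (-s * R) *
      (((R * besselQ R : ℝ) : ℂ) + s * (besselJ 0 R : ℂ))) atTop (nhds 0) := by
    rw [tendsto_zero_iff_norm_tendsto_zero]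
    simp only [norm_mul, norm_exp_neg_mul, hre, neg_zero, zero_mul, Real.exp_zero, one_mul]
    have h₁ := (Complex.continuous_ofReal.tendsto 0).comp tendsto_mul_besselQ
    have h₂ := (Complex.continuous_ofReal.tendsto 0).comp tendsto_besselJ_zero
    simpa using (h₁.add (h₂.const_mul s)).norm
  have hint := intervalIntegral_tendsto_integral_Ioi 0
    (integrableOn_exp_mul_besselQ hre.ge) tendsto_id
  have hlim := ((hbdry.const_sub s).sub hint).div_const (1 + s ^ 2)
  have hval : (s - 0 - ∫ t in Ioi (0 : ℝ), Complex.exp (-s * t) * (besselQ t : ℂ)) / (1 + s ^ 2) =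
      ((1 / √(1 - c ^ 2) : ℝ) : ℂ) := by
    have h := sub_laplaceBesselQ_neg_I_mul hc
    rw [← hs, laplaceBesselQ] at h
    rw [sub_zero, h, heq, ← Complex.ofReal_div, Real.sqrt_div_self']
  rw [hval] at hlim
  refine hlim.congr fun R => ?_
  rw [div_eq_iff hne, mul_comm (∫ _ in _.._, _), id, ← one_add_sq_mul_integral_exp_mul_besselJ_zero, hs, neg_neg]

open Filter in
theorem stmt10 (a b : ℝ) (ha : 0 < a) (hab : a < b) :
    Tendsto (fun R : ℝ => ∫ t in (0:ℝ)..R,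
        Complex.exp (Complex.I * a * t) * (besselJ 0 (b * t) : ℂ))
      atTop (nhds ((1 / Real.sqrt (b^2 - a^2) : ℝ) : ℂ)) := by
  have hb : 0 < b := ha.trans hab
  have hc : (a / b) ^ 2 < 1 := by
    rw [div_pow, div_lt_one (by positivity)]
    gcongr
  have h := ((tendsto_integral_exp_mul_besselJ_zero hc).comp
    (tendsto_id.const_mul_atTop hb)).const_smul (b⁻¹ : ℝ)
  have hval : (b⁻¹ : ℝ) • ((1 / √(1 - (a / b) ^ 2) : ℝ) : ℂ) =
      ((1 / Real.sqrt (b^2 - a^2) : ℝ) : ℂ) := by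
    have hsq : b ^ 2 - a ^ 2 = b ^ 2 * (1 - (a / b) ^ 2) := by field_simp
    rw [hsq, Real.sqrt_mul (by positivity), Real.sqrt_sq hb.le, Complex.real_smul,
      ← Complex.ofReal_mul, one_div, one_div, mul_inv]
  rw [hval] at h
  refine h.congr fun R => ?_
  have hsub := intervalIntegral.integral_comp_mul_left (a := 0) (b := R)
    (fun t : ℝ => Complex.exp (Complex.I * (a / b : ℝ) * t) * (besselJ 0 t : ℂ)) hb.ne'
  rw [mul_zero] at hsub
  simp only [Function.comp, id]
  rw [← hsub]
  refine intervalIntegral.integral_congr fun t _ => ?_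
  have : (b : ℂ) ≠ 0 := by exact_mod_cast hb.ne'
  congr 2
  push_cast
  field_simp
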